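/- Let Q be a uniformly sign-coherent ice quiver on n mutable vertices whose mutable subquiver is a fork with point of return r. Then there exists a mutation sequence of length at most n+4 taking Q to an ice quiver whose mutable subquiver is a fork, whose point of return is a green vertex, which has at most one other green vertex, and which has at least n-2 red vertices. -/

import Mathlib

open Matrix

section QuiverDefs

variable {V W : Type*}

/-- Mutation of an exchange matrix at the vertex `k`. -/
def mutB [DecidableEq V] (B : Matrix V V ℤ) (k : V) : Matrix V V ℤ :=
  Matrix.of fun i j =>
    if i = k ∨ j = k then -B i j else B i j + (B i k).sign * max (B i k * B k j) 0

/-- Mutation of the `C`-matrix of an extended exchange matrix `[B | C]` at the vertex `k`. -/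
def mutC [DecidableEq V] (B : Matrix V V ℤ) (C : Matrix V W ℤ) (k : V) : Matrix V W ℤ :=
  Matrix.of fun i j =>
    if i = k then -C i j else C i j + (B i k).sign * max (B i k * C k j) 0

/-- One mutation step on an extended exchange matrix `[B | C]`, regarded as a pair `(B, C)`. -/
def mutPair [DecidableEq V] (P : Matrix V V ℤ × Matrix V W ℤ) (k : V) :
    Matrix V V ℤ × Matrix V W ℤ :=
  (mutB P.1 k, mutC P.1 P.2 k)

/-- Iterated mutation of an extended exchange matrix along a list of mutable vertices. -/
def mutSeqPair [DecidableEq V] (P : Matrix V V ℤ × Matrix V W ℤ) (w : List V) :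
    Matrix V V ℤ × Matrix V W ℤ :=
  w.foldl mutPair P

/-- Iterated mutation of an exchange matrix along a list of vertices. -/
def mutSeqB [DecidableEq V] (B : Matrix V V ℤ) (w : List V) : Matrix V V ℤ :=
  w.foldl mutB B

/-- A quiver is abundant if there are at least two arrows between any two distinct vertices. -/
def QAbundant (B : Matrix V V ℤ) : Prop := ∀ i j, i ≠ j → 2 ≤ |B i j|

/-- There is a directed cycle of the quiver `B` all of whose vertices lie in `S`. -/
def HasCycleIn (B : Matrix V V ℤ) (S : Set V) : Prop :=
  ∃ (x : V) (l : List V), x ∈ S ∧ (∀ y ∈ l, y ∈ S) ∧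
    List.Chain (fun i j => 0 < B i j) x (l ++ [x])

/-- A quiver is acyclic if it has no directed cycle. -/
def QAcyclic (B : Matrix V V ℤ) : Prop := ¬ HasCycleIn B Set.univ

/-- The vertex `x` is a source: all arrows at `x` point away from `x`. -/
def QSource (B : Matrix V V ℤ) (x : V) : Prop := ∀ j, 0 ≤ B x j

/-- The vertex `x` is a sink: all arrows at `x` point into `x`. -/
def QSink (B : Matrix V V ℤ) (x : V) : Prop := ∀ j, B x j ≤ 0

/-- `B` is a fork with point of return `r`: it is abundant, not acyclic, the full subquiver
obtained by deleting `r` is acyclic, and for all `i` with `i → r` and `j` with `r → j` one has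
`b_{ji} > b_{ir}` and `b_{ji} > b_{rj}`. -/
def QFork (B : Matrix V V ℤ) (r : V) : Prop :=
  QAbundant B ∧ ¬ QAcyclic B ∧ ¬ HasCycleIn B {x | x ≠ r} ∧
    ∀ i j, 0 < B i r → 0 < B r j → B i r < B j i ∧ B r j < B j i

/-- The mutable vertex `i` is green: its `c`-vector is nonzero with all entries `≥ 0`. -/
def QGreen (C : Matrix V W ℤ) (i : V) : Prop := (∀ j, 0 ≤ C i j) ∧ C i ≠ 0

/-- The mutable vertex `i` is red: its `c`-vector is nonzero with all entries `≤ 0`. -/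
def QRed (C : Matrix V W ℤ) (i : V) : Prop := (∀ j, C i j ≤ 0) ∧ C i ≠ 0

/-- The mutable vertex `i` is blue: its `c`-vector is zero. -/
def QBlue (C : Matrix V W ℤ) (i : V) : Prop := C i = 0

/-- `i` has the same color (red/green/blue) with respect to `C` and to `C'`. -/
def SameColorQ (C C' : Matrix V W ℤ) (i : V) : Prop :=
  (QRed C i ↔ QRed C' i) ∧ (QGreen C i ↔ QGreen C' i) ∧ (QBlue C i ↔ QBlue C' i)

/-- The `c`-vectors of `i` and `j` have the same sign (`sgn(c_i) = sgn(c_j)`). -/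
def SameSignQ (C : Matrix V W ℤ) (i j : V) : Prop :=
  (QGreen C i ∧ QGreen C j) ∨ (QRed C i ∧ QRed C j)

/-- The `c`-vectors of `i` and `j` have opposite signs (`sgn(c_i) = -sgn(c_j)`). -/
def OppSignQ (C : Matrix V W ℤ) (i j : V) : Prop :=
  (QGreen C i ∧ QRed C j) ∨ (QRed C i ∧ QGreen C j)

/-- An ice quiver is uniformly sign-coherent if after every mutation sequence every mutable
vertex is red, green, or blue, and not every mutable vertex of the initial quiver is blue. -/
def USC [DecidableEq V] (P : Matrix V V ℤ × Matrix V W ℤ) : Prop :=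
  (∀ (w : List V) (i : V),
      QRed (mutSeqPair P w).2 i ∨ QGreen (mutSeqPair P w).2 i ∨ QBlue (mutSeqPair P w).2 i) ∧
    ¬ ∀ i, QBlue P.2 i

/-- An ice quiver is strictly sign-coherent if after every mutation sequence every mutable
vertex is red or green. -/
def SSC [DecidableEq V] (P : Matrix V V ℤ × Matrix V W ℤ) : Prop :=
  ∀ (w : List V) (i : V), QRed (mutSeqPair P w).2 i ∨ QGreen (mutSeqPair P w).2 i

/-- The four sign conditions at the distinguished vertex `r`:
(1) every mutable vertex is red or green;
(2) if every entry of `b_{rj}·c_j` is `≥ 0` for some `j ≠ r`, then `sgn(c_j) = sgn(c_r)` or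
    `sgn(c_j)·c_j ≥ sgn(c_r)·c_r` entrywise (i.e. `|c_r| ≤ |c_j|` entrywise);
(3) if every entry of `b_{rj}·c_j` is `≤ 0` for some `j ≠ r`, then `sgn(c_j) = -sgn(c_r)`;
(4) if every entry of `b_{ij}·c_j` is `≥ 0` for distinct `i, j` both `≠ r`,
    then `sgn(c_i) = sgn(c_j)`. -/
def FourConds (Bw : Matrix V V ℤ) (Cw : Matrix V W ℤ) (r : V) : Prop :=
  (∀ i, QRed Cw i ∨ QGreen Cw i) ∧
  (∀ j, j ≠ r → (∀ t, 0 ≤ Bw r j * Cw j t) →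
    (SameSignQ Cw j r ∨ ∀ t, |Cw r t| ≤ |Cw j t|)) ∧
  (∀ j, j ≠ r → (∀ t, Bw r j * Cw j t ≤ 0) → OppSignQ Cw j r) ∧
  (∀ i j, i ≠ j → i ≠ r → j ≠ r → (∀ t, 0 ≤ Bw i j * Cw j t) → SameSignQ Cw i j)

end QuiverDefs

section Helpers

variable {V : Type*} [DecidableEq V]

/-- Convenient reformulation of a fork (together with skew-symmetry). -/
structure Fk (B : Matrix V V ℤ) (k : V) : Prop where
  skew : ∀ i j, B j i = -B i j
  ab : ∀ i j, i ≠ j → 2 ≤ B i j ∨ 2 ≤ B j i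
  tr : ∀ x y z, x ≠ k → y ≠ k → z ≠ k → 0 < B x y → 0 < B y z → 0 < B x z
  cond : ∀ i j, 0 < B i k → 0 < B k j → B i k < B j i ∧ B k j < B j i
  hin : ∃ i, 0 < B i k
  hout : ∃ j, 0 < B k j

theorem mutB_self_right (B : Matrix V V ℤ) (k x : V) : mutB B k x k = -B x k := by
  simp [mutB]

theorem mutB_self_left (B : Matrix V V ℤ) (k x : V) : mutB B k k x = -B k x := by
  simp [mutB]

theorem mutB_pos {B : Matrix V V ℤ} {k x y : V} (hx : x ≠ k) (hy : y ≠ k)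
    (h1 : 0 < B x k) (h2 : 0 < B k y) : mutB B k x y = B x y + B x k * B k y := by
  have : 0 < B x k * B k y := mul_pos h1 h2
  simp [mutB, hx, hy, Int.sign_eq_one_of_pos h1, max_eq_left this.le]

theorem mutB_neg {B : Matrix V V ℤ} {k x y : V} (hx : x ≠ k) (hy : y ≠ k)
    (h1 : B x k < 0) (h2 : B k y < 0) : mutB B k x y = B x y - B x k * B k y := by
  have : 0 < B x k * B k y := mul_pos_of_neg_of_neg h1 h2
  simp [mutB, hx, hy, Int.sign_eq_neg_one_of_neg h1, max_eq_left this.le]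
  ring

theorem mutB_same1 {B : Matrix V V ℤ} {k x y : V} (hx : x ≠ k) (hy : y ≠ k)
    (h1 : 0 ≤ B x k) (h2 : B k y ≤ 0) : mutB B k x y = B x y := by
  have : B x k * B k y ≤ 0 := mul_nonpos_of_nonneg_of_nonpos h1 h2
  simp [mutB, hx, hy, max_eq_right this]

theorem mutB_same2 {B : Matrix V V ℤ} {k x y : V} (hx : x ≠ k) (hy : y ≠ k)
    (h1 : B x k ≤ 0) (h2 : 0 ≤ B k y) : mutB B k x y = B x y := by
  have : B x k * B k y ≤ 0 := mul_nonpos_of_nonpos_of_nonneg h1 h2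
  simp [mutB, hx, hy, max_eq_right this]

theorem mutB_skew {B : Matrix V V ℤ} (h : ∀ i j, B j i = -B i j) (k : V) (i j : V) :
    mutB B k j i = - mutB B k i j := by
  by_cases hi : i = k
  · subst hi; rw [mutB_self_right, mutB_self_left, h]
  by_cases hj : j = k
  · subst hj; rw [mutB_self_right, mutB_self_left, h]
  have e1 := h i k
  have e2 := h j k
  have e3 := h i j
  rcases le_total 0 (B i k) with a | a <;> rcases le_total 0 (B k j) with b | b
  · rcases a.eq_or_lt with a' | a'
    · rw [mutB_same2 hi hj (by omega) (by omega)]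
      rcases b.eq_or_lt with b' | b'
      · rw [mutB_same1 hj hi (by omega) (by omega)]; omega
      · rw [mutB_same2 hj hi (by omega) (by omega)]; omega
    · rcases b.eq_or_lt with b' | b'
      · rw [mutB_same1 hi hj (by omega) (by omega), mutB_same1 hj hi (by omega) (by omega)]; omega
      · rw [mutB_pos hi hj (by omega) (by omega), mutB_neg hj hi (by omega) (by omega), e3, e1,
          show B j k = - B k j by omega]; ring
  · rw [mutB_same1 hi hj (by omega) (by omega), mutB_same1 hj hi (by omega) (by omega)]; omega
  · rw [mutB_same2 hi hj (by omega) (by omega), mutB_same2 hj hi (by omega) (by omega)]; omega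
  · rcases a.eq_or_lt with a' | a'
    · rw [mutB_same1 hi hj (by omega) (by omega)]
      rcases b.eq_or_lt with b' | b'
      · rw [mutB_same1 hj hi (by omega) (by omega)]; omega
      · rw [mutB_same1 hj hi (by omega) (by omega)]; omega
    · rcases b.eq_or_lt with b' | b'
      · rw [mutB_same2 hi hj (by omega) (by omega), mutB_same2 hj hi (by omega) (by omega)]; omega
      · rw [mutB_neg hi hj (by omega) (by omega), mutB_pos hj hi (by omega) (by omega), e3, e1,
          show B j k = - B k j by omega]; ring

namespace Fk

variable {B : Matrix V V ℤ} {r k : V}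

theorem tot (h : Fk B r) {x y : V} (hxy : x ≠ y) : 0 < B x y ∨ 0 < B y x := by
  have := h.ab x y hxy; omega

theorem asymm (h : Fk B r) {x y : V} (h1 : 0 < B x y) (h2 : 0 < B y x) : False := by
  have := h.skew x y; omega

theorem ne (h : Fk B r) {x y : V} (h1 : 0 < B x y) : x ≠ y := by
  rintro rfl; exact h.asymm h1 h1

theorem two (h : Fk B r) {x y : V} (h1 : 0 < B x y) : 2 ≤ B x y := by
  have := h.ab x y (h.ne h1)
  have := h.skew x y
  omega

/-- Every path of length two through `k` between nonpor vertices is shortcut; the order of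
the vertices different from `r` and `k` stays. -/
theorem m2 (h : Fk B r) (hk : k ≠ r) {x y : V} (hx : x ≠ k) (hy : y ≠ k) (hxr : x ≠ r)
    (hyr : y ≠ r) (hxy : 0 < B x y) : B x y ≤ mutB B k x y := by
  have e1 := h.skew x k
  have e2 := h.skew y k
  rcases h.tot hx with a | a <;> rcases h.tot hy with b | b
  · rw [mutB_same1 hx hy (by omega) (by omega)]
  · rw [mutB_pos hx hy a b]; have := mul_pos a b; omega
  · exact (h.asymm hxy (h.tr _ _ _ hyr hk hxr b a)).elim
  · rw [mutB_same2 hx hy (by omega) (by omega)]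

theorem m3 (h : Fk B r) (hk : 0 < B r k) {y : V} (hy : y ≠ k) (hyr : y ≠ r) :
    0 < mutB B k r y ∧ (0 < B k y → B k y < mutB B k r y ∧ B r k < mutB B k r y) := by
  have hrk := h.ne hk
  have e2 := h.skew y k
  have e3 := h.skew y r
  have := h.two hk
  rcases h.tot hyr with a | a
  · have c := h.cond y k a hk
    have := h.two a
    have hky : 0 < B k y := by omega
    rw [mutB_pos hrk hy hk hky]
    have : B r k * B k y ≥ 2 * B k y := by nlinarith
    omega
  · have := h.two a
    rcases h.tot hy with b | b
    · rw [mutB_same1 hrk hy (by omega) (by omega)]; omega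
    · rw [mutB_pos hrk hy hk b]
      have := h.two b
      have : B r k * B k y ≥ 2 * B k y := by nlinarith
      have : B r k * B k y ≥ B r k * 2 := by nlinarith
      omega

theorem m4 (h : Fk B r) (hk : 0 < B k r) {y : V} (hy : y ≠ k) (hyr : y ≠ r) :
    0 < mutB B k y r ∧ (0 < B y k → B y k < mutB B k y r ∧ B k r < mutB B k y r) := by
  have hrk := (h.ne hk).symm
  have e2 := h.skew y k
  have e3 := h.skew y r
  have := h.two hk
  rcases h.tot hyr with a | a
  · have := h.two a
    rcases h.tot hy with b | b
    · rw [mutB_pos hy hrk b hk]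
      have := h.two b
      have : B y k * B k r ≥ B y k * 2 := by nlinarith
      have : B y k * B k r ≥ 2 * B k r := by nlinarith
      omega
    · rw [mutB_same2 hy hrk (by omega) (by omega)]; omega
  · have c := h.cond k y hk a
    have := h.two a
    have hky : 0 < B y k := by omega
    rw [mutB_pos hy hrk hky hk]
    have : B y k * B k r ≥ B y k * 2 := by nlinarith
    omega

theorem mutate (h : Fk B r) (hk : k ≠ r) : Fk (mutB B k) k := by
  have sk := mutB_skew h.skew k
  have key : ∀ x y, x ≠ k → y ≠ k → x ≠ r → y ≠ r → (0 < mutB B k x y ↔ 0 < B x y) := by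
    intro x y hx hy hxr hyr
    constructor
    · intro hh
      by_contra hc
      by_cases hxy : x = y
      · subst hxy; have := sk x x; omega
      rcases h.tot hxy with a | a
      · exact hc a
      · have := h.m2 hk hy hx hyr hxr a
        have := sk x y; omega
    · intro a; have := h.m2 hk hx hy hxr hyr a; omega
  refine ⟨sk, ?_, ?_, ?_, ?_, ?_⟩
  · have aux : ∀ i j, i ≠ k → j ≠ k → i ≠ r → j ≠ r → 0 < B i j → 2 ≤ mutB B k i j := by
      intro i j a b c d e
      have := h.m2 hk a b c d e
      have := h.two e; omega
    have aux2 : ∀ y, y ≠ k → y ≠ r → 2 ≤ mutB B k r y ∨ 2 ≤ mutB B k y r := by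
      intro y hy hyr
      have e2 := h.skew y k
      have e3 := h.skew y r
      have s3 := sk y r
      have e4 := h.skew r k
      rcases h.tot hk with a | a
      · right
        have m := h.m4 a hy hyr
        rcases h.tot hy with b | b
        · have := h.two b; have := m.2 b; omega
        · rw [mutB_same2 hy hk.symm (by omega) (by omega)] at m ⊢
          exact h.two m.1
      · left
        have m := h.m3 a hy hyr
        rcases h.tot hy with b | b
        · rw [mutB_same1 hk.symm hy (by omega) (by omega)] at m ⊢
          exact h.two m.1
        · have := h.two b; have := m.2 b; omega
    intro i j hij
    by_cases hi : i = k
    · subst hi; rw [mutB_self_left, mutB_self_right]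
      have := h.ab i j hij; have := h.skew i j; omega
    by_cases hj : j = k
    · subst hj; rw [mutB_self_left, mutB_self_right]
      have := h.ab i j hij; have := h.skew i j; omega
    by_cases hir : i = r
    · subst hir; exact aux2 j hj (Ne.symm hij)
    by_cases hjr : j = r
    · subst hjr; exact (aux2 i hi hij).symm
    rcases h.tot hij with a | a
    · left; exact aux _ _ hi hj hir hjr a
    · right; exact aux _ _ hj hi hjr hir a
  · intro x y z hx hy hz h1 h2
    by_cases hxz : x = z
    · subst hxz; have := sk x y; omega
    have nxy : x ≠ y := by rintro rfl; have := sk x x; omega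
    have nyz : y ≠ z := by rintro rfl; have := sk y y; omega
    rcases h.tot hk with a | a
    · have m := fun y hy hyr => (h.m4 a (y := y) hy hyr).1
      by_cases hxr : x = r
      · subst hxr; have := m y hy nxy.symm; have := sk x y; omega
      by_cases hyr : y = r
      · subst hyr; have := m z hz nyz.symm; have := sk y z; omega
      by_cases hzr : z = r
      · subst hzr; exact m x hx hxr
      rw [key _ _ (by assumption) (by assumption) (by assumption) (by assumption)] at *
      exact h.tr x y z hxr hyr hzr h1 h2
    · have m := fun y hy hyr => (h.m3 a (y := y) hy hyr).1
      by_cases hzr : z = r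
      · subst hzr; have := m y hy nyz; have := sk y z; omega
      by_cases hyr : y = r
      · subst hyr; have := m x hx nxy; have := sk x y; omega
      by_cases hxr : x = r
      · subst hxr; exact m z hz hzr
      rw [key _ _ (by assumption) (by assumption) (by assumption) (by assumption)] at *
      exact h.tr x y z hxr hyr hzr h1 h2
  · intro i j h1 h2
    rw [mutB_self_right] at h1 ⊢
    rw [mutB_self_left] at h2 ⊢
    have e1 := h.skew i k
    have e2 := h.skew j k
    have e3 := h.skew i j
    have ki : 0 < B k i := by omega
    have jk : 0 < B j k := by omega
    have nik := h.ne ki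
    have njk := h.ne jk
    have nij : i ≠ j := by rintro rfl; exact h.asymm ki jk
    by_cases hir : i = r
    · subst hir
      have := (h.m4 ki njk nij.symm).2 jk; omega
    by_cases hjr : j = r
    · subst hjr
      have := (h.m3 jk nik.symm nij).2 ki; omega
    have ji := h.tr _ _ _ hjr hk hir jk ki
    rw [mutB_pos njk nik.symm jk ki]
    have := h.two jk
    have := h.two ki
    have : B j k * B k i ≥ 2 * B k i := by nlinarith
    have : B j k * B k i ≥ B j k * 2 := by nlinarith
    omega
  · have : ∃ i, 0 < B k i := by
      rcases h.tot hk with a | a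
      · exact ⟨r, a⟩
      · obtain ⟨i, hi⟩ := h.hin
        have := h.cond i k hi a
        exact ⟨i, by omega⟩
    obtain ⟨i, hi⟩ := this
    exact ⟨i, by rw [mutB_self_right]; have := h.skew i k; omega⟩
  · have : ∃ i, 0 < B i k := by
      rcases h.tot hk with a | a
      · obtain ⟨i, hi⟩ := h.hout
        have := h.cond k i a hi
        exact ⟨i, by omega⟩
      · exact ⟨r, a⟩
    obtain ⟨i, hi⟩ := this
    exact ⟨i, by rw [mutB_self_left]; have := h.skew i k; omega⟩

theorem key (h : Fk B r) (hk : k ≠ r) {x y : V} (hx : x ≠ k) (hy : y ≠ k) (hxr : x ≠ r)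
    (hyr : y ≠ r) : 0 < mutB B k x y ↔ 0 < B x y := by
  have sk := mutB_skew h.skew k
  constructor
  · intro hh
    by_contra hc
    by_cases hxy : x = y
    · subst hxy; have := sk x x; omega
    rcases h.tot hxy with a | a
    · exact hc a
    · have := h.m2 hk hy hx hyr hxr a
      have := sk x y; omega
  · intro a; have := h.m2 hk hx hy hxr hyr a; omega

theorem k1 (h : Fk B r) {x : V} : 0 < mutB B k x k ↔ 0 < B k x := by
  rw [mutB_self_right]; have := h.skew x k; omega

theorem k2 (h : Fk B r) {x : V} : 0 < mutB B k k x ↔ 0 < B x k := by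
  rw [mutB_self_left]; have := h.skew x k; omega

/-- out-neighbours of the point of return precede its in-neighbours -/
theorem out_in (h : Fk B r) {i j : V} (hi : 0 < B i r) (hj : 0 < B r j) : 0 < B j i := by
  have := h.cond i j hi hj; omega

theorem exists_min (h : Fk B r) (A : Finset V) (hA : A.Nonempty) (hr : r ∉ A) :
    ∃ a ∈ A, ∀ x ∈ A, x ≠ a → 0 < B a x := by
  induction hA using Finset.Nonempty.cons_induction with
  | singleton a => exact ⟨a, by simp, by simp⟩
  | cons a s ha hs ih =>
    rw [Finset.mem_cons, not_or] at hr
    obtain ⟨b, hb, hmin⟩ := ih hr.2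
    have hab : a ≠ b := by rintro rfl; exact ha hb
    rcases h.tot hab with c | c
    · refine ⟨a, by simp, ?_⟩
      intro x hx hxa
      rw [Finset.mem_cons] at hx
      rcases hx with hx | hx
      · exact (hxa hx).elim
      · by_cases hxb : x = b
        · subst hxb; exact c
        · exact h.tr a b x (Ne.symm hr.1) (by rintro rfl; exact hr.2 hb)
            (by rintro rfl; exact hr.2 hx) c (hmin x hx hxb)
    · refine ⟨b, by simp [hb], ?_⟩
      intro x hx hxb
      rw [Finset.mem_cons] at hx
      rcases hx with hx | hx
      · subst hx; exact c
      · exact hmin x hx hxb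

end Fk

/-- Mutation of a single frozen column. -/
def mutS (B : Matrix V V ℤ) (s : V → ℤ) (k : V) : V → ℤ := fun i =>
  if i = k then -s i else s i + (B i k).sign * max (B i k * s k) 0

theorem mutS_self (B : Matrix V V ℤ) (s : V → ℤ) (k : V) : mutS B s k k = - s k := by
  simp [mutS]

theorem mutS_pos {B : Matrix V V ℤ} {s : V → ℤ} {k x : V} (hx : x ≠ k) (h : 0 < B x k)
    (hs : 0 ≤ s k) : mutS B s k x = s x + B x k * s k := by
  have : 0 ≤ B x k * s k := mul_nonneg h.le hs
  simp [mutS, hx, Int.sign_eq_one_of_pos h, max_eq_left this]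

theorem mutS_neg {B : Matrix V V ℤ} {s : V → ℤ} {k x : V} (hx : x ≠ k) (h : B x k < 0)
    (hs : s k ≤ 0) : mutS B s k x = s x - B x k * s k := by
  have : 0 ≤ B x k * s k := mul_nonneg_of_nonpos_of_nonpos h.le hs
  simp [mutS, hx, Int.sign_eq_neg_one_of_neg h, max_eq_left this]; ring

theorem mutS_same1 {B : Matrix V V ℤ} {s : V → ℤ} {k x : V} (hx : x ≠ k) (h : B x k ≤ 0)
    (hs : 0 ≤ s k) : mutS B s k x = s x := by
  have : B x k * s k ≤ 0 := mul_nonpos_of_nonpos_of_nonneg h hs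
  simp [mutS, hx, max_eq_right this]

theorem mutS_same2 {B : Matrix V V ℤ} {s : V → ℤ} {k x : V} (hx : x ≠ k) (h : 0 ≤ B x k)
    (hs : s k ≤ 0) : mutS B s k x = s x := by
  have : B x k * s k ≤ 0 := mul_nonpos_of_nonneg_of_nonpos h hs
  simp [mutS, hx, max_eq_right this]

namespace Fk
variable {B : Matrix V V ℤ} {r k x : V} {s : V → ℤ}

/-- red mutation kills dominated out-neighbours -/
theorem red_kill (h : Fk B r) (hx : 0 < B k x) (hk : s k < 0) (hs : s x ≤ - s k) :
    mutS B s k x < 0 := by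
  have := h.skew x k
  have := h.two hx
  rw [mutS_neg (h.ne hx).symm (by omega) hk.le]
  have : B x k * s k ≥ -2 * s k := by nlinarith
  omega

theorem red_same (h : Fk B r) (hx : 0 < B x k) (hk : s k ≤ 0) : mutS B s k x = s x :=
  mutS_same2 (h.ne hx) hx.le hk

/-- green mutation kills dominated in-neighbours -/
theorem green_kill (h : Fk B r) (hx : 0 < B x k) (hk : 0 < s k) (hs : - s k ≤ s x) :
    0 < mutS B s k x := by
  have := h.two hx
  rw [mutS_pos (h.ne hx) hx hk.le]
  have : B x k * s k ≥ 2 * s k := by nlinarith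
  omega

theorem green_same (h : Fk B r) (hx : 0 < B k x) (hk : 0 ≤ s k) : mutS B s k x = s x :=
  mutS_same1 (h.ne hx).symm (by have := h.skew x k; omega) hk

end Fk

/-- The scalar problem can be solved in at most `d` steps. -/
inductive Sol : ℕ → Matrix V V ℤ → (V → ℤ) → Prop
  | done (d : ℕ) (B : Matrix V V ℤ) (s : V → ℤ) (r f : V) (h : Fk B r) (hr : 0 < s r)
      (hs : ∀ x, x ≠ r → x ≠ f → s x < 0) : Sol d B s
  | step (d : ℕ) (B : Matrix V V ℤ) (s : V → ℤ) (k : V)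
      (h : Sol d (mutB B k) (mutS B s k)) : Sol (d + 1) B s

theorem sweep (N : ℕ) : ∀ (A : Finset V) (d : ℕ) (B : Matrix V V ℤ) (s : V → ℤ) (k f u : V),
    A.card = N → N + 1 ≤ d → Fk B k → f ≠ k → 0 < B k f →
    (∀ x, x ≠ f → x ≠ k → 0 < B x k ∧ 0 < B f x) → u ≠ f → u ∉ A → s u < 0 → f ∉ A → k ∉ A →
    (∀ x ∈ A, 0 ≤ s x) → (∀ x, x ∉ A → x ≠ f → s x ≤ 0) →
    (∀ x ∈ A, ∀ y, y ∉ A → y ≠ f → y ≠ k → 0 < B x y) →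
    (∀ x, x ∉ A → x ≠ f → x ≠ k → x ≠ u → 0 < B u x) → Sol d B s := by
  induction N with
  | zero =>
    intro A d B s k f u hA hd F hfk hkf hx huf huA hsu hfA hkA hA0 hD hAD hu
    obtain rfl : A = ∅ := Finset.card_eq_zero.mp hA
    obtain ⟨d, rfl⟩ : ∃ e, d = e + 1 := ⟨d - 1, by omega⟩
    have huk : u ≠ k := by
      rintro rfl
      obtain ⟨i, hi⟩ := F.hin
      have n1 := F.ne hi
      have n2 : i ≠ f := by rintro rfl; exact F.asymm hi hkf
      exact F.asymm hi (hu i (by simp) n2 n1 n1)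
    refine Sol.step d B s u (Sol.done d _ _ u f (F.mutate huk) (by rw [mutS_self]; omega) ?_)
    intro x hxu hxf
    have hs := hD x (by simp) hxf
    have : 0 < B u x := by
      by_cases hxk : x = k
      · subst hxk; exact (hx u huf huk).1
      · exact hu x (by simp) hxf hxk hxu
    exact F.red_kill this hsu (by omega)
  | succ N ih =>
    intro A d B s k f u hA hd F hfk hkf hx huf huA hsu hfA hkA hA0 hD hAD hu
    obtain ⟨d, rfl⟩ : ∃ e, d = e + 1 := ⟨d - 1, by omega⟩
    obtain ⟨a, haA, ha⟩ := F.exists_min A (Finset.card_pos.mp (by omega)) hkA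
    have hak : a ≠ k := by rintro rfl; exact hkA haA
    have haf : a ≠ f := by rintro rfl; exact hfA haA
    have hau : a ≠ u := by rintro rfl; exact huA haA
    have sa := hA0 a haA
    have hpos : ∀ x, x ≠ a → x ≠ f → 0 < B a x := by
      intro x hxa hxf
      by_cases hxk : x = k
      · subst hxk; exact (hx a haf hak).1
      by_cases hxA : x ∈ A
      · exact ha x hxA hxa
      · exact hAD a haA x hxA hxf hxk
    have hsame : ∀ x, x ≠ a → x ≠ f → mutS B s a x = s x := fun x h1 h2 =>
      F.green_same (hpos x h1 h2) sa
    have hbak := (hx a haf hak).1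
    refine Sol.step d B s a (ih (A.erase a) d _ _ a f u ?_ (by omega) (F.mutate hak) (Ne.symm haf)
      ?_ ?_ huf ?_ ?_ ?_ ?_ ?_ ?_ ?_ ?_)
    · rw [Finset.card_erase_of_mem haA]; omega
    · exact F.k2.2 (hx a haf hak).2
    · intro x hxf hxa
      refine ⟨F.k1.2 (hpos x hxa hxf), ?_⟩
      by_cases hxk : x = k
      · subst hxk; exact (F.m4 hbak haf.symm hfk).1
      · exact (F.key hak haf.symm hxa hfk hxk).2 (hx x hxf hxk).2
    · simp [huA]
    · rw [hsame u hau.symm huf]; exact hsu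
    · simp [hfA]
    · simp
    · intro x hxA
      rw [Finset.mem_erase] at hxA
      rw [hsame x hxA.1 (by rintro rfl; exact hfA hxA.2)]
      exact hA0 x hxA.2
    · intro x hxA hxf
      by_cases hxa : x = a
      · subst hxa; rw [mutS_self]; omega
      · rw [hsame x hxa hxf]
        exact hD x (fun hh => hxA (Finset.mem_erase.2 ⟨hxa, hh⟩)) hxf
    · intro x hxA y hyA hyf hya
      rw [Finset.mem_erase] at hxA
      have hxk : x ≠ k := by rintro rfl; exact hkA hxA.2
      by_cases hyk : y = k
      · subst hyk; exact (F.m4 hbak hxA.1 hxk).1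
      · refine (F.key hak hxA.1 hya hxk hyk).2 (hAD x hxA.2 y ?_ hyf hyk)
        exact (fun hh => hyA (Finset.mem_erase.2 ⟨hya, hh⟩))
    · intro x hxA hxf hxa hxu
      have hxA' : x ∉ A := (fun hh => hxA (Finset.mem_erase.2 ⟨hxa, hh⟩))
      by_cases hxk : x = k
      · subst hxk; exact (F.m4 hbak hau.symm hxu.symm).1
      · have := hu x hxA' hxf hxk hxu
        have huk : u ≠ k := by
          rintro rfl
          exact F.asymm this (hx x hxf hxk).1
        exact (F.key hak hau.symm hxa huk hxk).2 this

variable [Fintype V]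

open Classical in
/-- Late red vertices. -/
noncomputable def lateReds (B : Matrix V V ℤ) (s : V → ℤ) (k : V) : Finset V :=
  Finset.univ.filter fun x => x ≠ k ∧ s x < 0 ∧ ∀ y, y ≠ k → 0 < B x y → s y ≤ 0

def NPlus (B : Matrix V V ℤ) (s : V → ℤ) (k : V) : Prop :=
  0 < s k ∧ ∀ x, 0 < B x k → s x < 0

def NMinus (B : Matrix V V ℤ) (s : V → ℤ) (k : V) : Prop :=
  s k < 0 ∧ ∀ x, 0 < B k x → 0 < s x

open Classical in
theorem final_case {B : Matrix V V ℤ} {s : V → ℤ} {k : V} {d : ℕ} (F : Fk B k)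
    (hN : NPlus B s k ∨ NMinus B s k)
    (hno : ∀ x y, x ≠ k → y ≠ k → s x < 0 → 0 < B x y → s y ≤ 0)
    (hd : Fintype.card V ≤ (lateReds B s k).card + d) : Sol d B s := by
  set A : Finset V := Finset.univ.filter fun x => x ≠ k ∧ 0 ≤ s x ∧
    ∀ y, y ≠ k → s y < 0 → 0 < B x y with hAdef
  have hkA : k ∉ A := by simp [hAdef]
  have hcard : A.card + (lateReds B s k).card + 1 ≤ Fintype.card V := by
    have hdis : Disjoint A (lateReds B s k) := by
      rw [Finset.disjoint_left]
      intro x hx hx'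
      simp only [hAdef, lateReds, Finset.mem_filter] at hx hx'
      omega
    rw [← Finset.card_union_of_disjoint hdis]
    have : k ∉ A ∪ lateReds B s k := by simp [hkA, lateReds]
    rw [← Finset.card_insert_of_notMem this]
    exact Finset.card_le_univ _
  have hA0 : ∀ x ∈ A, 0 ≤ s x := by
    intro x hx; simp only [hAdef, Finset.mem_filter] at hx; exact hx.2.2.1
  have hDred : ∀ x, x ∉ A → x ≠ k → ∃ y, y ≠ k ∧ s y < 0 ∧ (y = x ∨ 0 < B y x) := by
    intro x hx hxk
    by_contra hc
    push Not at hc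
    apply hx
    simp only [hAdef, Finset.mem_filter, Finset.mem_univ, true_and]
    refine ⟨hxk, ?_, ?_⟩
    · by_contra hh
      exact (hc x hxk (by omega)).1 rfl
    · intro y hy hsy
      have := hc y hy hsy
      rcases F.tot this.1 with a | a
      · omega
      · exact a
  have hD : ∀ x, x ∉ A → x ≠ k → s x ≤ 0 := by
    intro x hx hxk
    obtain ⟨y, hy, hsy, rfl | h⟩ := hDred x hx hxk
    · omega
    · exact hno y x hy hxk hsy h
  have hAD : ∀ x ∈ A, ∀ y, y ∉ A → y ≠ k → 0 < B x y := by
    intro x hx y hy hyk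
    obtain ⟨z, hz, hsz, h⟩ := hDred y hy hyk
    simp only [hAdef, Finset.mem_filter] at hx
    have := hx.2.2.2 z hz hsz
    rcases h with rfl | h
    · exact this
    · exact F.tr x z y hx.2.1 hz hyk this h
  -- a minimal vertex lies in the out-neighbourhood
  have hminout : ∀ a, a ≠ k → (∀ x, x ≠ k → x ≠ a → 0 < B a x) → 0 < B k a := by
    intro a hak ha
    rcases F.tot hak with c | c
    · obtain ⟨j, hj⟩ := F.hout
      have h1 := F.out_in c hj
      exact (F.asymm h1 (ha j (F.ne hj).symm (F.ne h1))).elim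
    · exact c
  -- first element of the complement
  set D : Finset V := Finset.univ.filter fun x => x ∉ A ∧ x ≠ k with hDdef
  have hkD : k ∉ D := by simp [hDdef]
  have hmemD : ∀ x, x ∈ D ↔ x ∉ A ∧ x ≠ k := by intro x; simp [hDdef]
  have hDmin : D.Nonempty → ∃ u, u ∉ A ∧ u ≠ k ∧ s u < 0 ∧ ∀ x, x ∉ A → x ≠ k → x ≠ u →
      0 < B u x := by
    intro hne
    obtain ⟨u, huD, hu⟩ := F.exists_min D hne hkD
    have huD' := (hmemD u).1 huD
    refine ⟨u, huD'.1, huD'.2, ?_, fun x h1 h2 h3 => hu x ((hmemD x).2 ⟨h1, h2⟩) h3⟩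
    obtain ⟨y, hy, hsy, rfl | h⟩ := hDred u huD'.1 huD'.2
    · exact hsy
    · have hyA : y ∉ A := fun hh => by have := hA0 y hh; omega
      exact (F.asymm h (hu y ((hmemD y).2 ⟨hyA, hy⟩) (F.ne h))).elim
  obtain ⟨d, rfl⟩ : ∃ e, d = e + 1 := ⟨d - 1, by omega⟩
  by_cases hAe : A.Nonempty
  · obtain ⟨a, haA, ha⟩ := F.exists_min A hAe hkA
    have hak : a ≠ k := by rintro rfl; exact hkA haA
    have hpos : ∀ x, x ≠ k → x ≠ a → 0 < B a x := by
      intro x hxk hxa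
      by_cases hxA : x ∈ A
      · exact ha x hxA hxa
      · exact hAD a haA x hxA hxk
    have hka := hminout a hak hpos
    have sa := hA0 a haA
    have hsame : ∀ x, x ≠ a → x ≠ k → mutS B s a x = s x := fun x h1 h2 =>
      F.green_same (hpos x h2 h1) sa
    have hcA : (A.erase a).card + 1 = A.card := Finset.card_erase_add_one haA
    have hU : ∃ u, u ≠ k ∧ u ∉ A.erase a ∧ mutS B s a u < 0 ∧
        ∀ x, x ∉ A.erase a → x ≠ k → x ≠ a → x ≠ u → 0 < mutB B a u x := by
      by_cases hDe : D.Nonempty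
      · obtain ⟨u, huA, huk, hsu, hu⟩ := hDmin hDe
        have hua : u ≠ a := by rintro rfl; exact huA haA
        refine ⟨u, huk, by simp [huA], by rw [hsame u hua huk]; exact hsu, ?_⟩
        intro x hxA hxk hxa hxu
        have hxA' : x ∉ A := (fun hh => hxA (Finset.mem_erase.2 ⟨hxa, hh⟩))
        exact (F.key hak hua hxa huk hxk).2 (hu x hxA' hxk hxu)
      · have hall : ∀ x, x ≠ k → x ∈ A := by
          intro x hxk
          by_contra hh
          exact hDe ⟨x, (hmemD x).2 ⟨hh, hxk⟩⟩
        refine ⟨a, hak, by simp, ?_, ?_⟩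
        · rw [mutS_self]
          rcases hN with hN | hN
          · obtain ⟨i, hi⟩ := F.hin
            have := hN.2 i hi
            have := hA0 i (hall i (F.ne hi))
            omega
          · have := hN.2 a hka; omega
        · intro x hxA hxk hxa hxu
          exact (hxA (Finset.mem_erase.2 ⟨hxa, hall x hxk⟩)).elim
    obtain ⟨u, huk, huA, hsu, hu⟩ := hU
    refine Sol.step d B s a (sweep (A.erase a).card (A.erase a) d _ _ a k u rfl (by omega)
      (F.mutate hak) hak.symm (F.k2.2 hka) ?_ huk huA hsu ?_ ?_ ?_ ?_ ?_ hu)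
    · intro x hxk hxa
      exact ⟨F.k1.2 (hpos x hxk hxa), (F.m3 hka hxa hxk).1⟩
    · simp [hkA]
    · simp
    · intro x hxA
      rw [Finset.mem_erase] at hxA
      rw [hsame x hxA.1 (by rintro rfl; exact hkA hxA.2)]
      exact hA0 x hxA.2
    · intro x hxA hxk
      by_cases hxa : x = a
      · subst hxa; rw [mutS_self]; omega
      · rw [hsame x hxa hxk]
        exact hD x (fun hh => hxA (Finset.mem_erase.2 ⟨hxa, hh⟩)) hxk
    · intro x hxA y hyA hyk hya
      rw [Finset.mem_erase] at hxA
      have hxk : x ≠ k := by rintro rfl; exact hkA hxA.2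
      refine (F.key hak hxA.1 hya hxk hyk).2 (hAD x hxA.2 y ?_ hyk)
      exact (fun hh => hyA (Finset.mem_erase.2 ⟨hya, hh⟩))
  · rw [Finset.not_nonempty_iff_eq_empty] at hAe
    have hDe : D.Nonempty := by
      obtain ⟨i, hi⟩ := F.hin
      exact ⟨i, (hmemD i).2 ⟨by simp [hAe], F.ne hi⟩⟩
    obtain ⟨u, huA, huk, hsu, hu⟩ := hDmin hDe
    refine Sol.step d B s u (Sol.done d _ _ u k (F.mutate huk) (by rw [mutS_self]; omega) ?_)
    intro x hxu hxk
    have hxA : x ∉ A := by simp [hAe]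
    have := hD x hxA hxk
    exact F.red_kill (hu x hxA hxk hxu) hsu (by omega)

theorem mem_late {B : Matrix V V ℤ} {s : V → ℤ} {k x : V} :
    x ∈ lateReds B s k ↔ x ≠ k ∧ s x < 0 ∧ ∀ y, y ≠ k → 0 < B x y → s y ≤ 0 := by
  simp [lateReds]

open Classical in
/-- One step in the presence of an inversion. -/
theorem step_case {B : Matrix V V ℤ} {s : V → ℤ} {k : V} (F : Fk B k)
    (hN : NPlus B s k ∨ NMinus B s k)
    (hinv : ∃ x y, x ≠ k ∧ y ≠ k ∧ s x < 0 ∧ 0 < B x y ∧ 0 < s y) :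
    ∃ z, z ≠ k ∧
      ((NPlus (mutB B z) (mutS B s z) z ∧
        (lateReds B s k).card + (if s k < 0 then 2 else 1) ≤
          (lateReds (mutB B z) (mutS B s z) z).card) ∨
       (NMinus (mutB B z) (mutS B s z) z ∧
        (lateReds B s k).card + (if s k < 0 then 1 else 0) ≤
          (lateReds (mutB B z) (mutS B s z) z).card)) := by
  set P : Finset V := Finset.univ.filter fun z => z ≠ k ∧
    (∃ x, x ≠ k ∧ s x < 0 ∧ (x = z ∨ 0 < B x z)) ∧
    (∃ y, y ≠ k ∧ 0 < s y ∧ (z = y ∨ 0 < B z y)) with hP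
  have memP : ∀ z, z ∈ P ↔ z ≠ k ∧
    (∃ x, x ≠ k ∧ s x < 0 ∧ (x = z ∨ 0 < B x z)) ∧
    (∃ y, y ≠ k ∧ 0 < s y ∧ (z = y ∨ 0 < B z y)) := by intro z; simp [hP]
  obtain ⟨x0, y0, hx0, hy0, sx0, bxy, sy0⟩ := hinv
  have hx0P : x0 ∈ P := (memP x0).2 ⟨hx0, ⟨x0, hx0, sx0, Or.inl rfl⟩, ⟨y0, hy0, sy0, Or.inr bxy⟩⟩
  obtain ⟨z, hzP, hzmax⟩ := P.exists_max_image (fun z => |s z|) ⟨x0, hx0P⟩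
  have hz0 : s z ≠ 0 := by
    intro hh
    have := hzmax x0 hx0P
    simp only [hh, abs_zero] at this
    have : s x0 = 0 := abs_nonpos_iff.1 this
    omega
  obtain ⟨hzk, ⟨xr, hxrk, sxr, hxr⟩, ⟨yg, hygk, syg, hyg⟩⟩ := (memP z).1 hzP
  refine ⟨z, hzk, ?_⟩
  have F' := F.mutate hzk
  rcases lt_or_gt_of_ne hz0 with hz | hz
  · -- red step
    left
    have hzy : 0 < B z yg := by
      rcases hyg with rfl | h
      · omega
      · exact h
    have hmax : ∀ w ∈ P, s w ≤ - s z := by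
      intro w hw
      have h1 := hzmax w hw
      have h2 : |s z| = - s z := abs_of_neg hz
      have h3 := le_abs_self (s w)
      omega
    have kill : ∀ w, 0 < B z w → mutS B s z w < 0 := by
      intro w hw
      apply F.red_kill hw hz
      by_cases hwk : w = k
      · subst hwk
        rcases hN with hN | hN
        · -- then z is an in-neighbour, so is yg
          exfalso
          rcases F.tot hygk with a | a
          · have := hN.2 _ a; omega
          · exact F.asymm hzy (F.out_in hw a)
        · have := hN.1; omega
      · by_cases hsw : s w ≤ 0
        · omega
        · apply hmax
          exact (memP w).2 ⟨hwk, ⟨z, hzk, hz, Or.inr hw⟩, ⟨w, hwk, by omega, Or.inl rfl⟩⟩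
    have hNew : NPlus (mutB B z) (mutS B s z) z := by
      refine ⟨by rw [mutS_self]; omega, fun x hx => kill x (F.k1.1 hx)⟩
    refine ⟨hNew, ?_⟩
    have hsub : ∀ x, 0 < B z x → x ∈ lateReds (mutB B z) (mutS B s z) z := by
      intro x hx
      rw [mem_late]
      refine ⟨(F.ne hx).symm, kill x hx, ?_⟩
      intro y hyz hxy
      rcases F'.tot hyz with a | a
      · exact (kill y (F.k1.1 a)).le
      · exact (F'.asymm hxy (F'.out_in (F.k1.2 hx) a)).elim
    have hold : ∀ x ∈ lateReds B s k, 0 < B z x := by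
      intro x hx
      rw [mem_late] at hx
      have hxz : x ≠ z := by
        rintro rfl
        have := hx.2.2 yg hygk hzy; omega
      rcases F.tot hxz with a | a
      · have := hx.2.2 yg hygk (F.tr _ _ _ hx.1 hzk hygk a hzy); omega
      · exact a
    have hygn : yg ∉ lateReds B s k := by rw [mem_late]; omega
    have hkn : k ∉ lateReds B s k := by rw [mem_late]; simp
    split_ifs with hsk
    · have hzk' : 0 < B z k := by
        rcases F.tot hzk with a | a
        · exact a
        · rcases hN with hN | hN
          · have := hN.1; omega
          · have := hN.2 z a; omega
      have h1 : insert k (insert yg (lateReds B s k)) ⊆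
          lateReds (mutB B z) (mutS B s z) z := by
        intro x hx
        simp only [Finset.mem_insert] at hx
        rcases hx with rfl | rfl | hx
        · exact hsub _ hzk'
        · exact hsub _ hzy
        · exact hsub _ (hold _ hx)
      have h2 := Finset.card_le_card h1
      rw [Finset.card_insert_of_notMem (by simp [hkn, hygk.symm]),
        Finset.card_insert_of_notMem hygn] at h2
      omega
    · have h1 : insert yg (lateReds B s k) ⊆
          lateReds (mutB B z) (mutS B s z) z := by
        intro x hx
        simp only [Finset.mem_insert] at hx
        rcases hx with rfl | hx
        · exact hsub _ hzy
        · exact hsub _ (hold _ hx)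
      have h2 := Finset.card_le_card h1
      rw [Finset.card_insert_of_notMem hygn] at h2
      omega
  · -- green step
    right
    have hxz : 0 < B xr z := by
      rcases hxr with rfl | h
      · omega
      · exact h
    have hmax : ∀ w ∈ P, - s z ≤ s w := by
      intro w hw
      have h1 := hzmax w hw
      have h2 : |s z| = s z := abs_of_pos hz
      have h3 := neg_abs_le (s w)
      omega
    have zdir : (s k < 0 → 0 < B z k) ∧ (0 < s k → 0 < B k z) := by
      constructor
      · intro hsk
        rcases hN with hN | hN
        · have := hN.1; omega
        · rcases F.tot hzk with a | a
          · exact a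
          · exfalso
            rcases F.tot hxrk with c | c
            · exact F.asymm hxz (F.out_in c a)
            · have := hN.2 _ c; omega
      · intro hsk
        rcases hN with hN | hN
        · rcases F.tot hzk with a | a
          · have := hN.2 _ a; omega
          · exact a
        · have := hN.1; omega
    have kill : ∀ w, 0 < B w z → 0 < mutS B s z w := by
      intro w hw
      apply F.green_kill hw hz
      by_cases hwk : w = k
      · subst hwk
        by_cases hsk : s w < 0
        · exact (F.asymm hw (zdir.1 hsk)).elim
        · omega
      · by_cases hsw : 0 ≤ s w
        · omega
        · apply hmax
          exact (memP w).2 ⟨hwk, ⟨w, hwk, by omega, Or.inl rfl⟩, ⟨z, hzk, hz, Or.inr hw⟩⟩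
    have hNew : NMinus (mutB B z) (mutS B s z) z := by
      refine ⟨by rw [mutS_self]; omega, fun x hx => kill x (F.k2.1 hx)⟩
    refine ⟨hNew, ?_⟩
    have hold : ∀ x ∈ lateReds B s k, x ∈ lateReds (mutB B z) (mutS B s z) z := by
      intro x hx
      rw [mem_late] at hx ⊢
      obtain ⟨hxk, sx, hx⟩ := hx
      have hxz : x ≠ z := by rintro rfl; omega
      have bzx : 0 < B z x := by
        rcases F.tot hxz with a | a
        · have := hx z hzk a; omega
        · exact a
      refine ⟨hxz, by rw [F.green_same bzx hz.le]; exact sx, ?_⟩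
      intro y hyz hxy
      by_cases hyk : y = k
      · subst hyk
        rcases hN with hN | hN
        · have := (F.m3 (zdir.2 hN.1) hxz hxk).1
          exact (F'.asymm this hxy).elim
        · rw [F.green_same (zdir.1 hN.1) hz.le]; exact hN.1.le
      · have bxy := (F.key hzk hxz hyz hxk hyk).1 hxy
        rw [F.green_same (F.tr _ _ _ hzk hxk hyk bzx bxy) hz.le]
        exact hx y hyk bxy
    have hkn : k ∉ lateReds B s k := by rw [mem_late]; simp
    split_ifs with hsk
    · have hbzk := zdir.1 hsk
      have hk' : k ∈ lateReds (mutB B z) (mutS B s z) z := by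
        rw [mem_late]
        refine ⟨hzk.symm, by rw [F.green_same hbzk hz.le]; exact hsk, ?_⟩
        intro y hyz hky
        have hyk : y ≠ k := (F'.ne hky).symm
        exact (F'.asymm hky (F.m4 hbzk hyz hyk).1).elim
      have h1 : insert k (lateReds B s k) ⊆ lateReds (mutB B z) (mutS B s z) z := by
        intro x hx
        simp only [Finset.mem_insert] at hx
        rcases hx with rfl | hx
        · exact hk'
        · exact hold _ hx
      have h2 := Finset.card_le_card h1
      rw [Finset.card_insert_of_notMem hkn] at h2
      omega
    · have := Finset.card_le_card (show lateReds B s k ⊆ _ from hold)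
      omega

theorem nice_sol (d : ℕ) : ∀ (B : Matrix V V ℤ) (s : V → ℤ) (k : V), Fk B k →
    (NPlus B s k ∧ Fintype.card V + 1 ≤ (lateReds B s k).card + d ∨
      NMinus B s k ∧ Fintype.card V ≤ (lateReds B s k).card + d) → Sol d B s := by
  induction d with
  | zero =>
    intro B s k F h
    exfalso
    have hkn : k ∉ lateReds B s k := by rw [mem_late]; simp
    have := Finset.card_le_univ (insert k (lateReds B s k))
    rw [Finset.card_insert_of_notMem hkn] at this
    omega
  | succ d ih =>
    intro B s k F h
    have hN : NPlus B s k ∨ NMinus B s k := by tauto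
    by_cases hinv : ∃ x y, x ≠ k ∧ y ≠ k ∧ s x < 0 ∧ 0 < B x y ∧ 0 < s y
    · obtain ⟨z, hzk, hz⟩ := step_case F hN hinv
      refine Sol.step d B s z (ih _ _ z (F.mutate hzk) ?_)
      rcases h with ⟨h, hc⟩ | ⟨h, hc⟩
      · have h1 := h.1
        rw [if_neg (by omega), if_neg (by omega)] at hz
        rcases hz with ⟨hz, hc'⟩ | ⟨hz, hc'⟩
        · left; exact ⟨hz, by omega⟩
        · right; exact ⟨hz, by omega⟩
      · have h1 := h.1
        rw [if_pos (by omega), if_pos (by omega)] at hz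
        rcases hz with ⟨hz, hc'⟩ | ⟨hz, hc'⟩
        · left; exact ⟨hz, by omega⟩
        · right; exact ⟨hz, by omega⟩
    · refine final_case F hN ?_ (by omega)
      intro x y hx hy sx bxy
      by_contra hh
      exact hinv ⟨x, y, hx, hy, sx, bxy, by omega⟩

theorem max_sol {B : Matrix V V ℤ} {s : V → ℤ} {r x : V} (F : Fk B r) (hx : x ≠ r)
    (hs : s x ≠ 0) (hmax : ∀ y, |s y| ≤ |s x|) : Sol (Fintype.card V + 2) B s := by
  refine Sol.step _ B s x (nice_sol _ _ _ x (F.mutate hx) ?_)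
  rcases lt_or_gt_of_ne hs with h | h
  · left
    refine ⟨⟨by rw [mutS_self]; omega, fun y hy => ?_⟩, by omega⟩
    apply F.red_kill (F.k1.1 hy) h
    have := hmax y
    rw [abs_of_neg h] at this
    exact (le_abs_self _).trans this
  · right
    refine ⟨⟨by rw [mutS_self]; omega, fun y hy => ?_⟩, by omega⟩
    apply F.green_kill (F.k2.1 hy) h
    have := hmax y
    rw [abs_of_pos h] at this
    have := neg_abs_le (s y)
    omega

theorem max_sol' {B : Matrix V V ℤ} {s : V → ℤ} {r x : V} (F : Fk B r) (hx : x ≠ r)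
    (hs : s x ≠ 0) (hmax : |s r| ≤ |s x|) : Sol (Fintype.card V + 2) B s := by
  obtain ⟨z, -, hz⟩ := Finset.univ.exists_max_image (fun z => |s z|) ⟨x, Finset.mem_univ x⟩
  simp only [Finset.mem_univ, true_implies] at hz
  have hpos : 0 < |s x| := abs_pos.2 hs
  by_cases hzr : z = r
  · subst hzr
    exact max_sol F hx hs (fun y => (hz y).trans hmax)
  · refine max_sol F hzr (fun hh => ?_) hz
    have := hz x
    rw [hh, abs_zero] at this
    omega

theorem all_sol {B : Matrix V V ℤ} {s : V → ℤ} {r : V} (F : Fk B r) (hs : ∃ x, s x ≠ 0) :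
    Sol (Fintype.card V + 3) B s := by
  obtain ⟨x, hx⟩ := hs
  obtain ⟨z, -, hz⟩ := Finset.univ.exists_max_image (fun z => |s z|) ⟨x, Finset.mem_univ x⟩
  simp only [Finset.mem_univ, true_implies] at hz
  have hpos : 0 < |s x| := abs_pos.2 hx
  have hz0 : s z ≠ 0 := by
    intro hh
    have := hz x
    rw [hh, abs_zero] at this
    omega
  by_cases hzr : z = r
  · subst hzr
    rcases lt_or_gt_of_ne hz0 with h | h
    · obtain ⟨v, hv⟩ := F.hin
      have hvz := F.ne hv
      have hzv := hz v
      have hle : mutS B s v z ≤ s z := by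
        by_cases hsv : 0 ≤ s v
        · rw [F.green_same hv hsv]
        · have := F.skew v z
          rw [mutS_neg hvz.symm (by omega) (by omega)]
          have : 0 ≤ B z v * s v := mul_nonneg_of_nonpos_of_nonpos (by omega) (by omega)
          omega
      refine Sol.step _ B s v (max_sol' (F.mutate hvz) hvz.symm (by omega) ?_)
      rw [mutS_self, abs_neg]
      rw [abs_of_neg h] at hzv
      rw [abs_of_neg (show mutS B s v z < 0 by omega)]
      omega
    · obtain ⟨v, hv⟩ := F.hout
      have hvz := (F.ne hv).symm
      have hzv := hz v
      have hle : s z ≤ mutS B s v z := by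
        by_cases hsv : s v ≤ 0
        · rw [F.red_same hv hsv]
        · rw [mutS_pos hvz.symm (by omega) (by omega)]
          have : 0 ≤ B z v * s v := mul_nonneg (by omega) (by omega)
          omega
      refine Sol.step _ B s v (max_sol' (F.mutate hvz) hvz.symm (by omega) ?_)
      rw [mutS_self, abs_neg]
      rw [abs_of_pos h] at hzv
      rw [abs_of_pos (show 0 < mutS B s v z by omega)]
      omega
  · obtain ⟨v, hv⟩ := F.hin
    -- one spare mutation is not needed here
    have mono : ∀ (d : ℕ) (B : Matrix V V ℤ) (s : V → ℤ), Sol d B s → Sol (d + 1) B s := by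
      intro d B s h
      induction h with
      | done d B s r f h hr hs => exact Sol.done _ _ _ r f h hr hs
      | step d B s k h ih => exact Sol.step _ _ _ k ih
    exact mono _ _ _ (max_sol F hzr hz0 hz)

end Helpers

section Bridge

variable {V : Type*}

theorem chain_trans {R : V → V → Prop} (S : Set V)
    (tr : ∀ x y z, x ∈ S → y ∈ S → z ∈ S → R x y → R y z → R x z) :
    ∀ (l : List V) (x y : V), x ∈ S → y ∈ S → (∀ z ∈ l, z ∈ S) →
      List.IsChain R (x :: (l ++ [y])) → R x y := by
  intro l
  induction l with
  | nil => intro x y hx hy _ h; simpa using h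
  | cons a l ih =>
    intro x y hx hy hl h
    rw [List.cons_append, List.isChain_cons_cons] at h
    have ha : a ∈ S := hl a (by simp)
    exact tr x a y hx ha hy h.1 (ih a y ha hy (fun z hz => hl z (by simp [hz])) h.2)

theorem Fk.qfork [DecidableEq V] {B : Matrix V V ℤ} {r : V} (F : Fk B r) : QFork B r := by
  refine ⟨?_, ?_, ?_, F.cond⟩
  · intro i j hij
    rcases F.ab i j hij with h | h
    · exact h.trans (le_abs_self _)
    · rw [F.skew j i, abs_neg]; exact h.trans (le_abs_self _)
  · intro h
    obtain ⟨i, hi⟩ := F.hin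
    obtain ⟨j, hj⟩ := F.hout
    apply h
    refine ⟨r, [j, i], Set.mem_univ _, fun _ _ => Set.mem_univ _, ?_⟩
    have := F.out_in hi hj
    show List.IsChain _ [r, j, i, r]
    simp [hi, hj, this]
  · rintro ⟨x, l, hx, hl, hc⟩
    have := chain_trans {x | x ≠ r} (fun x y z => F.tr x y z) l x x hx hx hl hc
    exact F.asymm this this

theorem QFork.fk [DecidableEq V] {B : Matrix V V ℤ} {r : V} (hsk : ∀ i j, B j i = -B i j)
    (h : QFork B r) : Fk B r := by
  obtain ⟨hab, hcyc, hac, hcond⟩ := h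
  have ab : ∀ i j, i ≠ j → 2 ≤ B i j ∨ 2 ≤ B j i := by
    intro i j hij
    have := hab i j hij
    rw [le_abs] at this
    have := hsk i j
    omega
  have tr : ∀ x y z, x ≠ r → y ≠ r → z ≠ r → 0 < B x y → 0 < B y z → 0 < B x z := by
    intro x y z hx hy hz h1 h2
    by_contra hc
    have hxz : x ≠ z := by rintro rfl; have := hsk x y; omega
    have : 0 < B z x := by have := ab x z hxz; omega
    apply hac
    refine ⟨x, [y, z], hx, by simp [hy, hz], ?_⟩
    show List.IsChain _ [x, y, z, x]
    simp [h1, h2, this]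
  have irr : ∀ x, ¬ 0 < B x x := fun x hx => by have := hsk x x; omega
  rw [QAcyclic, not_not] at hcyc
  obtain ⟨x, l, -, -, hc⟩ := hcyc
  have key : (∀ i, ¬ 0 < B i r) ∨ (∀ i, ¬ 0 < B r i) → False := by
    intro hh
    have := chain_trans (R := fun i j => 0 < B i j) Set.univ ?_ l x x (Set.mem_univ _) (Set.mem_univ _)
      (fun _ _ => Set.mem_univ _) hc
    · exact irr x this
    · intro x y z _ _ _ h1 h2
      have n1 : x ≠ y := by rintro rfl; exact irr _ h1
      have n2 : y ≠ z := by rintro rfl; exact irr _ h2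
      have hxz : x ≠ z := by rintro rfl; have := hsk x y; omega
      have t := ab x z hxz
      rcases hh with hh | hh
      · have hy : y ≠ r := by rintro rfl; exact hh _ h1
        have hz : z ≠ r := by rintro rfl; exact hh _ h2
        by_cases hx : x = r
        · subst hx; have := hh z; omega
        · exact tr x y z hx hy hz h1 h2
      · have hx : x ≠ r := by rintro rfl; exact hh _ h1
        have hy : y ≠ r := by rintro rfl; exact hh _ h2
        by_cases hz : z = r
        · subst hz; have := hh x; omega
        · exact tr x y z hx hy hz h1 h2
  refine ⟨hsk, ab, tr, hcond, ?_, ?_⟩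
  · by_contra hh; push Not at hh
    exact key (Or.inl fun i => by have := hh i; omega)
  · by_contra hh; push Not at hh
    exact key (Or.inr fun i => by have := hh i; omega)

variable {W : Type*} [Fintype W]

/-- Row sums of the `C`-matrix. -/
def rowSum (C : Matrix V W ℤ) (i : V) : ℤ := ∑ t, C i t

theorem rowSum_mut [DecidableEq V] (B : Matrix V V ℤ) (C : Matrix V W ℤ) (k : V)
    (h : (∀ t, C k t ≤ 0) ∨ (∀ t, 0 ≤ C k t)) :
    rowSum (mutC B C k) = mutS B (rowSum C) k := by
  funext i
  by_cases hi : i = k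
  · simp [rowSum, mutC, mutS, hi]
  have hmax : ∑ t, max (B i k * C k t) 0 = max (B i k * rowSum C k) 0 := by
    unfold rowSum
    rw [Finset.mul_sum]
    have hcase : (∀ t, 0 ≤ B i k * C k t) ∨ (∀ t, B i k * C k t ≤ 0) := by
      rcases h with h | h <;> rcases le_total 0 (B i k) with b | b
      · exact Or.inr fun t => mul_nonpos_of_nonneg_of_nonpos b (h t)
      · exact Or.inl fun t => mul_nonneg_of_nonpos_of_nonpos b (h t)
      · exact Or.inl fun t => mul_nonneg b (h t)
      · exact Or.inr fun t => mul_nonpos_of_nonpos_of_nonneg b (h t)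
    rcases hcase with h | h
    · rw [max_eq_left (Finset.sum_nonneg fun t _ => h t)]
      exact Finset.sum_congr rfl fun t _ => max_eq_left (h t)
    · rw [max_eq_right (Finset.sum_nonpos fun t _ => h t)]
      exact Finset.sum_eq_zero fun t _ => max_eq_right (h t)
  simp only [rowSum, mutC, mutS, hi, Matrix.of_apply, if_false]
  rw [Finset.sum_add_distrib, ← Finset.mul_sum, hmax]
  rfl

theorem Sol.lift [DecidableEq V] {d : ℕ} {B : Matrix V V ℤ} {s : V → ℤ} (h : Sol d B s) :
    ∀ C : Matrix V W ℤ, rowSum C = s →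
    (∀ (w : List V) (i : V), QRed (mutSeqPair (B, C) w).2 i ∨ QGreen (mutSeqPair (B, C) w).2 i ∨
      QBlue (mutSeqPair (B, C) w).2 i) →
    ∃ w : List V, w.length ≤ d ∧ ∃ r f, QFork (mutSeqPair (B, C) w).1 r ∧
      QGreen (mutSeqPair (B, C) w).2 r ∧
      ∀ x, x ≠ r → x ≠ f → QRed (mutSeqPair (B, C) w).2 x := by
  induction h with
  | done d B s r f h hr hs =>
    rintro C rfl hco
    have hco := hco []
    simp only [mutSeqPair, List.foldl_nil] at hco
    refine ⟨[], by simp, r, f, h.qfork, ?_, ?_⟩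
    · rcases hco r with c | c | c
      · have : rowSum C r ≤ 0 := Finset.sum_nonpos fun t _ => c.1 t
        omega
      · exact c
      · have : rowSum C r = 0 := Finset.sum_eq_zero fun t _ => congrFun c t
        omega
    · intro x h1 h2
      have := hs x h1 h2
      rcases hco x with c | c | c
      · exact c
      · have : 0 ≤ rowSum C x := Finset.sum_nonneg fun t _ => c.1 t
        omega
      · have : rowSum C x = 0 := Finset.sum_eq_zero fun t _ => congrFun c t
        omega
  | step d B s k h ih =>
    rintro C rfl hco
    have h0 : (∀ t, C k t ≤ 0) ∨ (∀ t, 0 ≤ C k t) := by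
      rcases hco [] k with c | c | c
      · exact Or.inl c.1
      · exact Or.inr c.1
      · exact Or.inl fun t => (congrFun c t).le
    obtain ⟨w, hw, r, f, hh⟩ := ih (mutC B C k) (rowSum_mut B C k h0) (fun w => hco (k :: w))
    exact ⟨k :: w, by simp [hw], r, f, hh⟩

end Bridge

/-- Lemma `lem-usc-fork-mutate-green-por`. -/
theorem usc_fork_mutate_green_por {n m : ℕ}
    (B : Matrix (Fin n) (Fin n) ℤ) (C : Matrix (Fin n) (Fin m) ℤ)
    (hskew : ∀ i j, B j i = -B i j)
    (r : Fin n) (hfork : QFork B r)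
    (husc : USC (B, C)) :
    ∃ w : List (Fin n), w.length ≤ n + 4 ∧
      ∃ r' : Fin n, QFork (mutSeqPair (B, C) w).1 r' ∧
        QGreen (mutSeqPair (B, C) w).2 r' ∧
        {i : Fin n | QGreen (mutSeqPair (B, C) w).2 i}.ncard ≤ 2 ∧
        n - 2 ≤ {i : Fin n | QRed (mutSeqPair (B, C) w).2 i}.ncard := by
  have F := hfork.fk hskew
  have hne : ∃ x, rowSum C x ≠ 0 := by
    by_contra hc
    push Not at hc
    apply husc.2
    intro i
    have hi := hc i
    rcases husc.1 [] i with c | c | c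
    · funext t
      exact (Finset.sum_eq_zero_iff_of_nonpos (fun t _ => c.1 t)).1 hi t (Finset.mem_univ t)
    · funext t
      exact (Finset.sum_eq_zero_iff_of_nonneg (fun t _ => c.1 t)).1 hi t (Finset.mem_univ t)
    · exact c
  obtain ⟨w, hw, r', f, h1, h2, h3⟩ := (all_sol F hne).lift C rfl husc.1
  rw [Fintype.card_fin] at hw
  have hpair : ({r', f} : Set (Fin n)).ncard ≤ 2 := by
    have := Set.ncard_insert_le r' ({f} : Set (Fin n))
    rw [Set.ncard_singleton] at this
    omega
  refine ⟨w, by omega, r', h1, h2, ?_, ?_⟩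
  · have hsub : {i : Fin n | QGreen (mutSeqPair (B, C) w).2 i} ⊆ {r', f} := by
      intro x hx
      by_contra hc
      simp only [Set.mem_insert_iff, Set.mem_singleton_iff, not_or] at hc
      have hr := h3 x hc.1 hc.2
      have hg : QGreen (mutSeqPair (B, C) w).2 x := hx
      exact hr.2 (funext fun t => le_antisymm (hr.1 t) (hg.1 t))
    exact (Set.ncard_le_ncard hsub (Set.toFinite _)).trans hpair
  · have hsub : ({r', f} : Set (Fin n))ᶜ ⊆ {i : Fin n | QRed (mutSeqPair (B, C) w).2 i} := by
      intro x hx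
      simp only [Set.mem_compl_iff, Set.mem_insert_iff, Set.mem_singleton_iff, not_or] at hx
      exact h3 x hx.1 hx.2
    have a := Set.ncard_le_ncard hsub (Set.toFinite _)
    have b := Set.ncard_add_ncard_compl ({r', f} : Set (Fin n))
    have c := hpair
    rw [Nat.card_fin] at b
    omega
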